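/- arXiv:2511.11245 — 4 statements merged into one kernel-verified Lean document; each statement's English description precedes it below -/
import Mathlib

section
/- Fix a real number R > 0 and define f : ℝ × ℝ → ℝ by f(x, x') = |x - x'| / R, so that f(x, x') = 1 - s(x, x') where s(x, x') = 1 - |x - x'| / R is the Gower partial similarity for a numerical attribute with range R. Then f is conditionally negative definite: for every finite family x_1, …, x_n of reals and every real coefficients α_1, …, α_n with ∑_{i=1}^n α_i = 0, one has ∑_{i=1}^n ∑_{j=1}^n α_i α_j · |x_i - x_j| / R ≤ 0. -/
open MeasureTheory in
lemma gower_aux_int (M a b : ℝ) (ha : M ≤ a) (hb : M ≤ b) :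
    Integrable (fun t : ℝ => (Set.Ioc M a).indicator (fun _ => (1:ℝ)) t *
      (Set.Ioc M b).indicator (fun _ => (1:ℝ)) t) ∧
    |a - b| = a + b - 2 * M - 2 * ∫ t : ℝ, (Set.Ioc M a).indicator (fun _ => (1:ℝ)) t *
      (Set.Ioc M b).indicator (fun _ => (1:ℝ)) t := by
  have h : (fun t : ℝ => (Set.Ioc M a).indicator (fun _ => (1:ℝ)) t *
      (Set.Ioc M b).indicator (fun _ => (1:ℝ)) t) =
      (Set.Ioc M (min a b)).indicator (fun _ => (1:ℝ)) := by
    funext t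
    simp only [Set.indicator_apply, Set.mem_Ioc, le_min_iff]
    split_ifs <;> first | (exfalso; tauto) | simp
  rw [h]
  constructor
  · rw [integrable_indicator_iff measurableSet_Ioc]
    exact integrableOn_const (by simp)
  · rw [integral_indicator measurableSet_Ioc]
    have hm : M ≤ min a b := le_min ha hb
    simp only [integral_const, smul_eq_mul, mul_one, MeasurableSet.univ, measureReal_restrict_apply,
      Set.univ_inter, Real.volume_real_Ioc_of_le hm]
    rcases le_total a b with h | h
    · rw [min_eq_left h, abs_of_nonpos (by linarith)]; ring
    · rw [min_eq_right h, abs_of_nonneg (by linarith)]; ring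

open MeasureTheory in
lemma gower_aux (n : ℕ) (x : Fin n → ℝ) (α : Fin n → ℝ) (hα : ∑ i, α i = 0) :
    ∑ i, ∑ j, α i * α j * |x i - x j| ≤ 0 := by
  obtain ⟨M, hM⟩ : ∃ M, ∀ i, M ≤ x i := by
    obtain ⟨M, hM⟩ := (Set.finite_range x).bddBelow
    exact ⟨M, fun i => hM ⟨i, rfl⟩⟩
  let f : Fin n → ℝ → ℝ := fun i => (Set.Ioc M (x i)).indicator (fun _ => (1:ℝ))
  have hf : ∀ i j, Integrable (fun t => f i t * f j t) :=
    fun i j => (gower_aux_int M (x i) (x j) (hM i) (hM j)).1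
  have hg : ∀ i j, |x i - x j| = x i + x j - 2 * M - 2 * ∫ t, f i t * f j t :=
    fun i j => (gower_aux_int M (x i) (x j) (hM i) (hM j)).2
  have hpos : 0 ≤ ∑ i, ∑ j, α i * α j * ∫ t, f i t * f j t := by
    have : ∑ i, ∑ j, α i * α j * ∫ t, f i t * f j t = ∫ t, (∑ i, α i * f i t) ^ 2 := by
      have h2 : ∀ t, (∑ i, α i * f i t) ^ 2 = ∑ i, ∑ j, α i * α j * (f i t * f j t) := by
        intro t
        rw [sq, Finset.sum_mul_sum]
        exact Finset.sum_congr rfl fun i _ => Finset.sum_congr rfl fun j _ => by ring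
      simp_rw [h2]
      rw [integral_finsetSum _ fun i _ => integrable_finsetSum _ fun j _ => (hf i j).const_mul _]
      refine Finset.sum_congr rfl fun i _ => ?_
      rw [integral_finsetSum _ fun j _ => (hf i j).const_mul _]
      exact Finset.sum_congr rfl fun j _ => (integral_const_mul _ _).symm
    rw [this]
    exact integral_nonneg fun t => sq_nonneg _
  have key : ∑ i, ∑ j, α i * α j * |x i - x j| =
      (∑ i, α i * (x i - 2 * M)) * (∑ j, α j) + (∑ i, α i) * (∑ j, α j * x j)
      - 2 * ∑ i, ∑ j, α i * α j * ∫ t, f i t * f j t := by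
    rw [Finset.sum_mul_sum, Finset.sum_mul_sum, Finset.mul_sum, ← Finset.sum_add_distrib,
      ← Finset.sum_sub_distrib]
    refine Finset.sum_congr rfl fun i _ => ?_
    rw [Finset.mul_sum, ← Finset.sum_add_distrib, ← Finset.sum_sub_distrib]
    refine Finset.sum_congr rfl fun j _ => ?_
    rw [hg]; ring
  rw [key, hα]
  linarith


/-- For `R > 0`, the function `f(x, x') = |x - x'| / R`
(i.e. `1 - s(x,x')` where `s` is the Gower partial similarity for a numerical
attribute with range `R`) is conditionally negative definite. -/
theorem gower_numerical_dissimilarity_cnd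
    (R : ℝ) (hR : 0 < R)
    (n : ℕ) (x : Fin n → ℝ) (α : Fin n → ℝ)
    (hα : ∑ i, α i = 0) :
    ∑ i, ∑ j, α i * α j * (|x i - x j| / R) ≤ 0 := by
  have h := gower_aux n x α hα
  have e : ∑ i, ∑ j, α i * α j * (|x i - x j| / R) =
      (∑ i, ∑ j, α i * α j * |x i - x j|) / R := by
    rw [Finset.sum_div]
    refine Finset.sum_congr rfl fun i _ => ?_
    rw [Finset.sum_div]
    exact Finset.sum_congr rfl fun j _ => by ring
  rw [e]
  exact div_nonpos_of_nonpos_of_nonneg h hR.le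
end

section
/- Let X be a type with decidable equality and let γ > 0 be a real number. Define s'(x, x') = exp(-γ · (1 - s(x, x'))), where s(x, x') = 1 if x = x' and s(x, x') = 0 otherwise (the Gower partial similarity for a categorical attribute). Then s' is a positive definite kernel on X: s' is symmetric, and for every finite family x_1, …, x_n in X and all real coefficients c_1, …, c_n, ∑_{i=1}^n ∑_{j=1}^n c_i c_j s'(x_i, x_j) ≥ 0. -/
/-- The exponentially transformed Gower similarity for a categorical
attribute, `s'(x, x') = exp (-γ * (1 - s (x, x')))` with `s(x,x') = 1` if `x = x'`
and `0` otherwise, is a positive definite kernel for every `γ > 0`. -/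
theorem exp_gower_categorical_posdef
    {X : Type*} [DecidableEq X] (γ : ℝ) (hγ : 0 < γ) :
    (∀ x y : X,
      Real.exp (-γ * ((1 : ℝ) - (if x = y then (1 : ℝ) else 0))) =
      Real.exp (-γ * ((1 : ℝ) - (if y = x then (1 : ℝ) else 0)))) ∧
    (∀ (n : ℕ) (x : Fin n → X) (c : Fin n → ℝ),
      0 ≤ ∑ i, ∑ j,
        c i * c j * Real.exp (-γ * ((1 : ℝ) - (if x i = x j then (1 : ℝ) else 0)))) := by
  refine ⟨fun x y => by simp only [eq_comm], fun n x c => ?_⟩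
  have he : Real.exp (-γ) ≤ 1 := Real.exp_le_one_iff.mpr (by linarith)
  have hk : ∀ i j, Real.exp (-γ * ((1 : ℝ) - (if x i = x j then (1 : ℝ) else 0))) =
      Real.exp (-γ) + (1 - Real.exp (-γ)) *
        ∑ a ∈ Finset.univ.image x,
          (if x i = a then (1 : ℝ) else 0) * (if x j = a then (1 : ℝ) else 0) := by
    intro i j
    have : ∑ a ∈ Finset.univ.image x,
          (if x i = a then (1 : ℝ) else 0) * (if x j = a then (1 : ℝ) else 0)
          = if x i = x j then 1 else 0 := by
      rw [Finset.sum_eq_single (x i)]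
      · simp [eq_comm]
      · intro b _ hb
        simp [hb.symm]
      · intro h
        simp at h
    rw [this]
    split_ifs <;> simp
  have key : ∑ i, ∑ j,
        c i * c j * Real.exp (-γ * ((1 : ℝ) - (if x i = x j then (1 : ℝ) else 0))) =
      Real.exp (-γ) * (∑ i, c i) ^ 2 + (1 - Real.exp (-γ)) *
        ∑ a ∈ Finset.univ.image x, (∑ i, c i * (if x i = a then (1 : ℝ) else 0)) ^ 2 := by
    simp_rw [hk, pow_two, Finset.sum_mul_sum, mul_add, Finset.sum_add_distrib]
    congr 1
    · simp_rw [Finset.mul_sum]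
      exact Finset.sum_congr rfl fun i _ => Finset.sum_congr rfl fun j _ => by ring
    · rw [Finset.sum_comm (s := Finset.univ.image x), Finset.mul_sum]
      refine Finset.sum_congr rfl fun i _ => ?_
      rw [Finset.sum_comm (s := Finset.univ.image x), Finset.mul_sum]
      refine Finset.sum_congr rfl fun j _ => ?_
      simp_rw [Finset.mul_sum]
      exact Finset.sum_congr rfl fun a _ => by ring
  rw [key]
  have h1 : 0 ≤ 1 - Real.exp (-γ) := by linarith
  have h2 : 0 ≤ ∑ a ∈ Finset.univ.image x,
      (∑ i, c i * (if x i = a then (1 : ℝ) else 0)) ^ 2 :=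
    Finset.sum_nonneg fun a _ => sq_nonneg _
  exact add_nonneg (mul_nonneg (Real.exp_pos _).le (sq_nonneg _)) (mul_nonneg h1 h2)
end

section
/- Fix real numbers γ > 0 and R > 0. Define s' : ℝ × ℝ → ℝ by s'(x, x') = exp(-γ · |x - x'| / R), i.e. s'(x, x') = exp(-γ · (1 - s(x, x'))) where s(x, x') = 1 - |x - x'| / R is the Gower partial similarity for a numerical attribute with range R. Then s' is a positive definite kernel on ℝ: s' is symmetric, and for every finite family x_1, …, x_n of reals and all real coefficients c_1, …, c_n, ∑_{i=1}^n ∑_{j=1}^n c_i c_j s'(x_i, x_j) ≥ 0. -/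
open MeasureTheory in
lemma min_kernel_aux (n : ℕ) (t d : Fin n → ℝ) (ht : ∀ i, 0 ≤ t i) :
    0 ≤ ∑ i, ∑ j, d i * d j * min (t i) (t j) := by
  have hI : ∀ a : ℝ, Integrable ((Set.Ioc 0 a).indicator (fun _ : ℝ => (1 : ℝ))) volume := by
    intro a
    rw [integrable_indicator_iff measurableSet_Ioc]
    exact integrableOn_const (by simp)
  have hm : ∀ i j, d i * d j * min (t i) (t j) =
      ∫ u : ℝ, d i * d j * (Set.Ioc 0 (min (t i) (t j))).indicator (fun _ : ℝ => (1 : ℝ)) u := by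
    intro i j
    rw [integral_const_mul, integral_indicator measurableSet_Ioc]
    simp [ht i, ht j]
  simp_rw [hm]
  have : ∀ i, ∑ j, ∫ u : ℝ, d i * d j *
        (Set.Ioc 0 (min (t i) (t j))).indicator (fun _ : ℝ => (1 : ℝ)) u =
      ∫ u : ℝ, ∑ j, d i * d j *
        (Set.Ioc 0 (min (t i) (t j))).indicator (fun _ : ℝ => (1 : ℝ)) u := by
    intro i
    rw [integral_finsetSum]
    exact fun j _ => (hI _).const_mul _
  simp_rw [this]
  rw [← integral_finsetSum _
    (fun i _ => integrable_finsetSum _ (fun j _ => (hI _).const_mul _))]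
  apply integral_nonneg
  intro u
  have : ∑ i, ∑ j, d i * d j *
        (Set.Ioc 0 (min (t i) (t j))).indicator (fun _ : ℝ => (1 : ℝ)) u =
      (∑ i, d i * (Set.Ioc 0 (t i)).indicator (fun _ : ℝ => (1 : ℝ)) u) ^ 2 := by
    rw [sq, Finset.sum_mul_sum]
    refine Finset.sum_congr rfl fun i _ => Finset.sum_congr rfl fun j _ => ?_
    simp only [Set.indicator, Set.mem_Ioc, le_min_iff]
    split_ifs <;> first | (exfalso; tauto) | ring
  simp only [Pi.zero_apply]
  rw [this]
  positivity


/-- The exponentially transformed Gower similarity for a numerical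
attribute with range `R > 0`, `s'(x, x') = exp (-γ * |x - x'| / R)`, is a positive
definite kernel on `ℝ` for every `γ > 0`. -/
theorem exp_gower_numerical_posdef
    (γ R : ℝ) (hγ : 0 < γ) (hR : 0 < R) :
    (∀ x y : ℝ,
      Real.exp (-γ * (|x - y| / R)) = Real.exp (-γ * (|y - x| / R))) ∧
    (∀ (n : ℕ) (x : Fin n → ℝ) (c : Fin n → ℝ),
      0 ≤ ∑ i, ∑ j, c i * c j * Real.exp (-γ * (|x i - x j| / R))) := by
  refine ⟨fun x y => by rw [abs_sub_comm], fun n x c => ?_⟩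
  have h := min_kernel_aux n (fun i => Real.exp (2 * (γ / R * x i)))
    (fun i => c i * Real.exp (-(γ / R * x i))) (fun i => (Real.exp_pos _).le)
  refine h.trans_eq ?_
  refine Finset.sum_congr rfl fun i _ => Finset.sum_congr rfl fun j _ => ?_
  have hk : 0 < γ / R := div_pos hγ hR
  have key : ∀ a b : ℝ, a ≤ b → Real.exp (-(γ / R * a)) * Real.exp (-(γ / R * b)) *
      Real.exp (2 * (γ / R * a)) = Real.exp (-γ * ((b - a) / R)) := by
    intro a b _
    rw [← Real.exp_add, ← Real.exp_add]
    congr 1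
    ring
  have mono : ∀ a b : ℝ, a ≤ b → Real.exp (2 * (γ / R * a)) ≤ Real.exp (2 * (γ / R * b)) := by
    intro a b hab
    gcongr
  rcases le_total (x i) (x j) with hij | hij
  · rw [min_eq_left (mono _ _ hij), abs_sub_comm, abs_of_nonneg (sub_nonneg.2 hij),
      ← key _ _ hij]
    ring
  · rw [min_eq_right (mono _ _ hij), abs_of_nonneg (sub_nonneg.2 hij), ← key _ _ hij]
    ring
end

section
/- Let G and X be types, let P : X × X → ℝ be a positive definite kernel, let c : G → X be a map assigning to each structured object its center element, and let R : G → Finset X be a map assigning to each structured object the finite set of its decomposition elements. Define k_s(S, S') = ∑_{n ∈ R(S)} ∑_{n' ∈ R(S')} P(c(S), c(S')) · P(n, n'). Then k_s is a positive definite kernel on G: k_s is symmetric, and for every finite family S_1, …, S_n in G and all real coefficients c_1, …, c_n, ∑_{i=1}^n ∑_{j=1}^n c_i c_j k_s(S_i, S_j) ≥ 0. -/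
/-- Theorem 2 of the paper: the star subgraph kernel
`k_s(S, S') = ∑_{n ∈ R(S)} ∑_{n' ∈ R(S')} P(c S, c S') * P(n, n')`, with `P` a
positive definite kernel, `c` the center map and `R` the decomposition map, is a
positive definite kernel. -/
theorem star_subgraph_kernel_posdef
    {G X : Type*} (P : X × X → ℝ)
    (hsymm : ∀ x y, P (x, y) = P (y, x))
    (hpd : ∀ (n : ℕ) (x : Fin n → X) (c : Fin n → ℝ),
      0 ≤ ∑ i, ∑ j, c i * c j * P (x i, x j))
    (c : G → X) (R : G → Finset X) :
    (∀ S S' : G,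
      (∑ n ∈ R S, ∑ n' ∈ R S', P (c S, c S') * P (n, n')) =
      (∑ n ∈ R S', ∑ n' ∈ R S, P (c S', c S) * P (n, n'))) ∧
    (∀ (m : ℕ) (S : Fin m → G) (a : Fin m → ℝ),
      0 ≤ ∑ i, ∑ j, a i * a j *
        (∑ n ∈ R (S i), ∑ n' ∈ R (S j), P (c (S i), c (S j)) * P (n, n'))) := by
  have hpd' : ∀ (ι : Type) [Fintype ι] (x : ι → X) (d : ι → ℝ),
      0 ≤ ∑ i, ∑ j, d i * d j * P (x i, x j) := by
    intro ι _ x d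
    let e := (Fintype.equivFin ι).symm
    have h := hpd (Fintype.card ι) (x ∘ e) (d ∘ e)
    have h2 : ∑ i, ∑ j, d i * d j * P (x i, x j)
        = ∑ i, ∑ j, (d ∘ e) i * (d ∘ e) j * P ((x ∘ e) i, (x ∘ e) j) := by
      rw [← e.sum_comp]
      refine Finset.sum_congr rfl fun i _ => ?_
      rw [← e.sum_comp]
      rfl
    rw [h2]
    exact h
  constructor
  · intro S S'
    rw [Finset.sum_comm]
    refine Finset.sum_congr rfl fun n _ => Finset.sum_congr rfl fun n' _ => ?_
    rw [hsymm (c S), hsymm n']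
  · intro m S a
    let A : Matrix (Fin m) (Fin m) ℝ := fun i j => P (c (S i), c (S j))
    let B : Matrix (Fin m) (Fin m) ℝ :=
      fun i j => ∑ n ∈ R (S i), ∑ n' ∈ R (S j), P (n, n')
    have expand : ∀ (M : Matrix (Fin m) (Fin m) ℝ) (x : Fin m → ℝ),
        dotProduct (star x) (M.mulVec x) = ∑ i, ∑ j, x i * x j * M i j := by
      intro M x
      simp only [dotProduct, Matrix.mulVec, Finset.mul_sum, Pi.star_apply, star_trivial]
      refine Finset.sum_congr rfl fun i _ => Finset.sum_congr rfl fun j _ => ?_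
      ring
    have hA : A.PosSemidef := by
      rw [Matrix.posSemidef_iff_dotProduct_mulVec]
      refine ⟨?_, fun x => ?_⟩
      · ext i j
        exact hsymm (c (S j)) (c (S i))
      · rw [expand]
        exact hpd m (fun i => c (S i)) x
    have hB : B.PosSemidef := by
      rw [Matrix.posSemidef_iff_dotProduct_mulVec]
      refine ⟨?_, fun x => ?_⟩
      · ext i j
        change ∑ n ∈ R (S j), ∑ n' ∈ R (S i), P (n, n') = ∑ n ∈ R (S i), ∑ n' ∈ R (S j), P (n, n')
        rw [Finset.sum_comm]
        exact Finset.sum_congr rfl fun n _ => Finset.sum_congr rfl fun n' _ => hsymm _ _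
      · rw [expand]
        have h := hpd' (Σ i : Fin m, Fin (R (S i)).card)
          (fun p => ((R (S p.1)).equivFin.symm p.2 : X)) (fun p => x p.1)
        refine h.trans_eq ?_
        have key : ∀ (i : Fin m) (f : X → ℝ),
            ∑ q : Fin (R (S i)).card, f ((R (S i)).equivFin.symm q : X)
              = ∑ n ∈ R (S i), f n := by
          intro i f
          rw [(R (S i)).equivFin.symm.sum_comp (fun y => f (y : X))]
          exact Finset.sum_coe_sort (R (S i)) f
        simp only [Fintype.sum_sigma]
        refine Finset.sum_congr rfl fun i _ => ?_
        rw [Finset.sum_comm]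
        refine Finset.sum_congr rfl fun j _ => ?_
        simp only [B, ← Finset.mul_sum]
        congr 1
        rw [← key i]
        exact Finset.sum_congr rfl fun q _ =>
          key j (fun y => P (((R (S i)).equivFin.symm q : X), y))
    have h := (hA.hadamard hB).dotProduct_mulVec_nonneg a
    rw [expand] at h
    refine h.trans_eq ?_
    simp only [Matrix.hadamard_apply]
    simp only [A, B, Finset.mul_sum]
end
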